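/- Let G be a finite simple graph with n vertices, let k ≥ 1, and let p be the polynomial with rational coefficients satisfying p(λ) = χ_G^k(λ) for all positive integers λ. Then (−1)^n · p(−1) equals the number of k-balanced orientations of G. -/

import Mathlib

open Classical in
/-- Number of darts of a closed walk `c` that are oriented "forward" by the relation `r`. -/
noncomputable def fwdCount {V : Type*} {G : SimpleGraph V} {v : V}
    (r : V → V → Prop) (c : G.Walk v v) : ℕ :=
  (c.darts.filter fun d => decide (r d.toProd.1 d.toProd.2)).length

/-- A relation `r` (directing some of the edges of `G`) is `k`-balanced if along every
cycle of `G` at least `k` edges are directed forward by `r` and at least `k` backward. -/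
def KBalancedRel {V : Type*} (G : SimpleGraph V) (r : V → V → Prop) (k : ℕ) : Prop :=
  ∀ ⦃v : V⦄ (c : G.Walk v v), c.IsCycle →
    k ≤ fwdCount r c ∧ k ≤ fwdCount (fun i j => r j i) c

/-- An orientation of a simple graph `G`: for every edge `{i,j}` exactly one of
`(i,j)`, `(j,i)` is a directed edge. -/
structure GraphOrientation {V : Type*} (G : SimpleGraph V) where
  dir : V → V → Prop
  dir_adj : ∀ ⦃i j⦄, dir i j → G.Adj i j
  exactlyOne : ∀ ⦃i j⦄, G.Adj i j → (dir i j ↔ ¬ dir j i)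

/-- A `k`-balanced orientation. -/
def GraphOrientation.KBalanced {V : Type*} {G : SimpleGraph V} (O : GraphOrientation G)
    (k : ℕ) : Prop :=
  KBalancedRel G O.dir k

/-- An acyclic orientation: no directed cycles. -/
def GraphOrientation.Acyclic {V : Type*} {G : SimpleGraph V} (O : GraphOrientation G) : Prop :=
  Irreflexive (Relation.TransGen O.dir)

/-- A proper coloring of `G` by positive integers. -/
def IsProperColoring {V : Type*} (G : SimpleGraph V) (κ : V → ℕ+) : Prop :=
  ∀ ⦃i j⦄, G.Adj i j → κ i ≠ κ j

/-- A `k`-balanced coloring: a proper coloring whose induced orientation (each edge directed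
towards the larger color) is `k`-balanced. -/
def IsKBalancedColoring {V : Type*} (G : SimpleGraph V) (k : ℕ) (κ : V → ℕ+) : Prop :=
  IsProperColoring G κ ∧ KBalancedRel G (fun i j => κ i < κ j) k

/-- `χ_G^k(λ)`: the number of `k`-balanced colorings of `G` using colors from `{1,…,λ}`. -/
noncomputable def kChromCount {V : Type*} [Fintype V] (G : SimpleGraph V) (k : ℕ)
    (lam : ℕ) : ℕ :=
  Nat.card {κ : V → ℕ+ // IsKBalancedColoring G k κ ∧ ∀ v, (κ v : ℕ) ≤ lam}

theorem poly_antideriv (q : Polynomial ℚ) : ∃ r : Polynomial ℚ, r.eval 0 = 0 ∧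
    ∀ x : ℚ, r.eval (x + 1) = r.eval x + q.eval x := by
  induction q using Polynomial.induction_on' with
  | add a b ha hb =>
    obtain ⟨r, hr0, hr⟩ := ha
    obtain ⟨t, ht0, ht⟩ := hb
    refine ⟨r + t, by simp [hr0, ht0], fun x => ?_⟩
    simp only [Polynomial.eval_add, hr, ht]; ring
  | monomial n a =>
    refine ⟨Polynomial.C (a / (n + 1)) * (Polynomial.bernoulli (n + 1)
      - Polynomial.C ((Polynomial.bernoulli (n + 1)).eval 0)), by simp, fun x => ?_⟩
    have h := Polynomial.bernoulli_eval_one_add (n + 1) x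
    have h2 : (n : ℚ) + 1 ≠ 0 := by positivity
    rw [add_comm x 1]
    simp only [Polynomial.eval_mul, Polynomial.eval_C, Polynomial.eval_sub, h,
      Polynomial.eval_monomial]
    push_cast
    field_simp
    ring

open Classical in
/-- strict colorings of the part `S`, zero outside. -/
noncomputable def strictCol {V : Type*} [Fintype V] (r : V → V → Prop) (S : Finset V) (l : ℕ) :
    Finset (V → ℕ) :=
  (Fintype.piFinset (fun v => if v ∈ S then Finset.Icc 1 l else {0})).filter
    (fun κ => ∀ i ∈ S, ∀ j ∈ S, r i j → κ i < κ j)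

theorem mem_strictCol {V : Type*} [Fintype V] (r : V → V → Prop) (S : Finset V) (l : ℕ)
    (κ : V → ℕ) : κ ∈ strictCol r S l ↔ (∀ v ∈ S, 1 ≤ κ v ∧ κ v ≤ l) ∧ (∀ v, v ∉ S → κ v = 0) ∧
      ∀ i ∈ S, ∀ j ∈ S, r i j → κ i < κ j := by
  classical
  unfold strictCol
  rw [Finset.mem_filter, Fintype.mem_piFinset, ← and_assoc]
  refine and_congr_left fun _ => ⟨fun h => ⟨fun v hv => ?_, fun v hv => ?_⟩, fun h v => ?_⟩
  · simpa [hv] using h v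
  · simpa [hv] using h v
  · by_cases hv : v ∈ S
    · simpa [hv] using h.1 v hv
    · simpa [hv] using h.2 v hv

open Classical in
theorem strictCol_succ {V : Type*} [Fintype V] (r : V → V → Prop) (S : Finset V) (l : ℕ) :
    (strictCol r S (l + 1)).card =
      ∑ T ∈ (S.filter (fun v => ∀ w ∈ S, ¬ r v w)).powerset, (strictCol r (S \ T) l).card := by
  rw [Finset.card_eq_sum_card_fiberwise (f := fun κ : V → ℕ => S.filter (fun v => κ v = l + 1))
    (t := (S.filter (fun v => ∀ w ∈ S, ¬ r v w)).powerset)]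
  · refine Finset.sum_congr rfl fun T hT => ?_
    rw [Finset.mem_powerset] at hT
    have hT' : ∀ v ∈ T, v ∈ S ∧ ∀ w ∈ S, ¬ r v w := fun v hv => by simpa using hT hv
    refine Finset.card_bij' (fun κ _ v => if v ∈ T then 0 else κ v)
      (fun κ _ v => if v ∈ T then l + 1 else κ v) ?_ ?_ ?_ ?_
    · intro κ hκ
      rw [Finset.mem_filter, mem_strictCol] at hκ
      obtain ⟨⟨h1, h2, h3⟩, h4⟩ := hκ
      have h5 : ∀ v, v ∈ T ↔ v ∈ S ∧ κ v = l + 1 := fun v => by rw [← h4]; simp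
      rw [mem_strictCol]
      refine ⟨fun v hv => ?_, fun v hv => ?_, fun i hi j hj hij => ?_⟩
      · have := h1 v; have := h5 v; grind
      · have := h2 v; have := h5 v; grind
      · have := h3 i; grind
    · intro κ hκ
      rw [mem_strictCol] at hκ
      obtain ⟨h1, h2, h3⟩ := hκ
      rw [Finset.mem_filter, mem_strictCol]
      refine ⟨⟨fun v hv => ?_, fun v hv => ?_, fun i hi j hj hij => ?_⟩, ?_⟩
      · have := h1 v; grind
      · have := h2 v; have := hT' v; grind
      · have := h3 i; have := hT' i; have := h1 i; grind
      · ext v; have := h1 v; have := hT' v; grind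
    · intro κ hκ
      rw [Finset.mem_filter, mem_strictCol] at hκ
      obtain ⟨⟨h1, h2, h3⟩, h4⟩ := hκ
      have h5 : ∀ v, v ∈ T ↔ v ∈ S ∧ κ v = l + 1 := fun v => by rw [← h4]; simp
      funext v; have := h5 v; grind
    · intro κ hκ
      rw [mem_strictCol] at hκ
      funext v; have := hκ.2.1 v; grind
  · intro κ hκ
    have hκ' := (mem_strictCol r S (l + 1) κ).1 hκ
    obtain ⟨h1, h2, h3⟩ := hκ'
    rw [Finset.mem_coe, Finset.mem_powerset]
    intro v hv
    rw [Finset.mem_filter] at hv ⊢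
    refine ⟨hv.1, fun w hw hvw => ?_⟩
    have := h3 v hv.1 w hw hvw
    have := h1 w hw
    omega

theorem strictCol_poly {V : Type*} [Fintype V] (r : V → V → Prop)
    (hr : ∀ S : Finset V, S.Nonempty → ∃ v ∈ S, ∀ w ∈ S, ¬ r v w) (S : Finset V) :
    ∃ q : Polynomial ℚ, (∀ l : ℕ, q.eval (l : ℚ) = (strictCol r S l).card) ∧
      q.eval (-1) = (-1) ^ S.card := by
  classical
  induction S using Finset.strongInduction with
  | H S ih =>
  rcases S.eq_empty_or_nonempty with rfl | hS
  · refine ⟨1, fun l => ?_, by simp⟩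
    have : strictCol r ∅ l = {fun _ => 0} := by
      ext κ; rw [mem_strictCol]; simp [funext_iff]
    rw [this]; simp
  · set M := S.filter (fun v => ∀ w ∈ S, ¬ r v w) with hM
    have hMne : M.Nonempty := by
      obtain ⟨v, hv, h⟩ := hr S hS
      exact ⟨v, by simp [hM, hv]; exact h⟩
    have hMS : M ⊆ S := Finset.filter_subset _ _
    have hq : ∀ T : Finset V, ∃ q : Polynomial ℚ, (T ⊆ M ∧ T ≠ ∅) →
      (∀ l : ℕ, q.eval (l : ℚ) = (strictCol r (S \ T) l).card) ∧
      q.eval (-1) = (-1) ^ (S \ T).card := by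
      intro T
      by_cases h : T ⊆ M ∧ T ≠ ∅
      · obtain ⟨q, hq⟩ := ih (S \ T) (Finset.sdiff_ssubset (h.1.trans hMS)
          (Finset.nonempty_iff_ne_empty.2 h.2))
        exact ⟨q, fun _ => hq⟩
      · exact ⟨0, fun h' => absurd h' h⟩
    choose q hq using hq
    obtain ⟨R, hR0, hR⟩ := poly_antideriv (∑ T ∈ M.powerset.erase ∅, q T)
    have hmem : ∀ T ∈ M.powerset.erase ∅, T ⊆ M ∧ T ≠ ∅ := by
      intro T hT; rw [Finset.mem_erase, Finset.mem_powerset] at hT; exact ⟨hT.2, hT.1⟩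
    refine ⟨R, fun l => ?_, ?_⟩
    · induction l with
      | zero =>
        have : strictCol r S 0 = ∅ := by
          rw [Finset.eq_empty_iff_forall_notMem]
          intro κ hκ
          rw [mem_strictCol] at hκ
          obtain ⟨v, hv⟩ := hS
          have := hκ.1 v hv
          omega
        rw [this]; simpa using hR0
      | succ l ihl =>
        push_cast
        rw [hR, ihl, strictCol_succ, ← hM, ← Finset.add_sum_erase _ _ (Finset.empty_mem_powerset M),
          Finset.sdiff_empty, Polynomial.eval_finset_sum]
        push_cast
        congr 1
        exact Finset.sum_congr rfl fun T hT => (hq T (hmem T hT)).1 l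
    · have h := hR (-1)
      rw [neg_add_cancel, hR0, Polynomial.eval_finset_sum,
        Finset.sum_congr rfl fun T hT => (hq T (hmem T hT)).2] at h
      have h1 : ∑ T ∈ M.powerset, (-1 : ℚ) ^ (S \ T).card = 0 := by
        have h2 : ∀ T ∈ M.powerset, (-1 : ℚ) ^ (S \ T).card
            = (-1) ^ S.card * (((-1 : ℤ) ^ T.card : ℤ) : ℚ) := by
          intro T hT
          have h3 := Finset.card_sdiff_add_card_eq_card ((Finset.mem_powerset.1 hT).trans hMS)
          rw [← h3, pow_add, mul_assoc]
          push_cast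
          rw [← mul_pow]; simp
        rw [Finset.sum_congr rfl h2, ← Finset.mul_sum, ← Int.cast_sum,
          Finset.sum_powerset_neg_one_pow_card_of_nonempty hMne]
        simp
      rw [← Finset.add_sum_erase _ _ (Finset.empty_mem_powerset M), Finset.sdiff_empty] at h1
      linarith

theorem exists_dir_path {V : Type*} {G : SimpleGraph V} (O : GraphOrientation G) {a b : V}
    (h : Relation.ReflTransGen O.dir a b) :
    ∃ p : G.Walk a b, p.IsPath ∧ ∀ d ∈ p.darts, O.dir d.fst d.snd := by
  classical
  have : ∃ p : G.Walk a b, ∀ d ∈ p.darts, O.dir d.fst d.snd := by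
    induction h using Relation.ReflTransGen.head_induction_on with
    | refl => exact ⟨SimpleGraph.Walk.nil, by simp⟩
    | head hab _ ih =>
      obtain ⟨p, hp⟩ := ih
      refine ⟨SimpleGraph.Walk.cons (O.dir_adj hab) p, ?_⟩
      intro d hd
      rw [SimpleGraph.Walk.darts_cons, List.mem_cons] at hd
      rcases hd with rfl | hd
      · exact hab
      · exact hp d hd
  obtain ⟨p, hp⟩ := this
  exact ⟨p.bypass, p.bypass_isPath, fun d hd => hp d (p.darts_bypass_subset hd)⟩

theorem acyclic_of_balanced {V : Type*} {G : SimpleGraph V} (O : GraphOrientation G) {k : ℕ}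
    (hk : 1 ≤ k) (hO : O.KBalanced k) (v : V) : ¬ Relation.TransGen O.dir v v := by
  intro h
  obtain ⟨w, hvw, hwv⟩ := Relation.TransGen.head'_iff.1 h
  obtain ⟨p, hp, hd⟩ := exists_dir_path O hwv
  have hadj := O.dir_adj hvw
  have hnot := (O.exactlyOne hadj).1 hvw
  have hc : (SimpleGraph.Walk.cons hadj p).IsCycle := by
    rw [SimpleGraph.Walk.cons_isCycle_iff]
    refine ⟨hp, fun he => ?_⟩
    rw [SimpleGraph.Walk.edges, List.mem_map] at he
    obtain ⟨d, hdp, he⟩ := he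
    rw [SimpleGraph.dart_edge_eq_mk'_iff'] at he
    rcases he with ⟨h1, h2⟩ | ⟨h1, h2⟩
    · have h3 : w ∈ p.support.tail := by
        rw [← SimpleGraph.Walk.map_snd_darts, List.mem_map]
        exact ⟨d, hdp, h2⟩
      have h4 := hp.support_nodup
      rw [SimpleGraph.Walk.support_eq_cons, List.nodup_cons] at h4
      exact h4.1 h3
    · have := hd d hdp
      rw [h1, h2] at this
      exact hnot this
  have h1 := (hO _ hc).2
  have h0 : fwdCount (fun i j => O.dir j i) (SimpleGraph.Walk.cons hadj p) = 0 := by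
    unfold fwdCount
    rw [List.length_eq_zero_iff, List.filter_eq_nil_iff]
    intro d hdm
    have hdd : O.dir d.fst d.snd := by
      rw [SimpleGraph.Walk.darts_cons, List.mem_cons] at hdm
      rcases hdm with rfl | hdm
      · exact hvw
      · exact hd d hdm
    have := (O.exactlyOne d.adj).1 hdd
    simpa using this
  omega

theorem exists_sink {V : Type*} [Fintype V] {G : SimpleGraph V} (O : GraphOrientation G) {k : ℕ}
    (hk : 1 ≤ k) (hO : O.KBalanced k) (S : Finset V) (hS : S.Nonempty) :
    ∃ v ∈ S, ∀ w ∈ S, ¬ O.dir v w := by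
  let R : V → V → Prop := fun a b => Relation.TransGen O.dir b a
  haveI : IsTrans V R := ⟨fun a b c h1 h2 => h2.trans h1⟩
  haveI : Std.Irrefl R := ⟨fun a h => acyclic_of_balanced O hk hO a h⟩
  have wf : WellFounded R := Finite.wellFounded_of_trans_of_irrefl R
  obtain ⟨v, hv, h⟩ := wf.has_min (S : Set V) hS
  exact ⟨v, hv, fun w hw hvw => h w hw (Relation.TransGen.single hvw)⟩

theorem fwdCount_congr {V : Type*} {G : SimpleGraph V} {r s : V → V → Prop}
    (h : ∀ i j, G.Adj i j → (r i j ↔ s i j)) {v : V} (c : G.Walk v v) :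
    fwdCount r c = fwdCount s c := by
  unfold fwdCount
  congr 1
  exact List.filter_congr fun d _ => by simp [h _ _ d.adj]

theorem balanced_congr {V : Type*} {G : SimpleGraph V} {r s : V → V → Prop}
    (h : ∀ i j, G.Adj i j → (r i j ↔ s i j)) (k : ℕ) :
    KBalancedRel G r k ↔ KBalancedRel G s k := by
  unfold KBalancedRel
  refine forall_congr' fun v => forall_congr' fun c => ?_
  rw [fwdCount_congr h c, fwdCount_congr (r := fun i j => r j i) (s := fun i j => s j i)
    (fun i j hij => h j i hij.symm) c]

theorem orient_ext {V : Type*} {G : SimpleGraph V} {O O' : GraphOrientation G}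
    (h : ∀ i j, O.dir i j ↔ O'.dir i j) : O = O' := by
  cases O; cases O'; simp only [GraphOrientation.mk.injEq]
  funext i j; exact propext (h i j)

instance {V : Type*} [Finite V] (G : SimpleGraph V) : Finite (GraphOrientation G) :=
  Finite.of_injective (fun O : GraphOrientation G => O.dir)
    (fun _ _ h => orient_ext fun i j => iff_of_eq (congrFun (congrFun h i) j))

/-- The orientation induced by a coloring. -/
def colOrient {V : Type*} {G : SimpleGraph V} {κ : V → ℕ+} (h : IsProperColoring G κ) :
    GraphOrientation G where
  dir i j := G.Adj i j ∧ κ i < κ j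
  dir_adj _ _ h := h.1
  exactlyOne i j hij := by
    have := h hij
    constructor
    · rintro ⟨_, h1⟩ ⟨_, h2⟩
      exact lt_asymm h1 h2
    · intro h1
      refine ⟨hij, lt_of_le_of_ne (not_lt.1 fun h2 => h1 ⟨hij.symm, h2⟩) this⟩

theorem dir_iff_lt {V : Type*} {G : SimpleGraph V} (O : GraphOrientation G) {κ : V → ℕ+}
    (h : ∀ i j, O.dir i j → κ i < κ j) (i j : V) (hij : G.Adj i j) :
    κ i < κ j ↔ O.dir i j := by
  refine ⟨fun h1 => ?_, h i j⟩
  rw [O.exactlyOne hij]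
  exact fun h2 => lt_asymm h1 (h _ _ h2)

/-- Colorings are pairs of an orientation and a compatible coloring. -/
noncomputable def colEquiv {V : Type*} [Fintype V] (G : SimpleGraph V) (k l : ℕ) :
    {κ : V → ℕ+ // IsKBalancedColoring G k κ ∧ ∀ v, (κ v : ℕ) ≤ l} ≃
    Σ O : {O : GraphOrientation G // O.KBalanced k}, strictCol O.1.dir Finset.univ l where
  toFun κ := ⟨⟨colOrient κ.2.1.1, (balanced_congr (fun i j hij => by simp [colOrient, hij]) k).1
    κ.2.1.2⟩, ⟨fun v => κ.1 v, by
      rw [mem_strictCol]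
      exact ⟨fun v _ => ⟨(κ.1 v).2, κ.2.2 v⟩, fun v hv => absurd (Finset.mem_univ v) hv,
        fun i _ j _ hij => hij.2⟩⟩⟩
  invFun x := by
    have h := (mem_strictCol _ _ _ _).1 x.2.2
    let κ : V → ℕ+ := fun v => ⟨x.2.1 v, (h.1 v (Finset.mem_univ v)).1⟩
    have hκ : ∀ i j, x.1.1.dir i j → κ i < κ j := fun i j hij =>
      h.2.2 i (Finset.mem_univ i) j (Finset.mem_univ j) hij
    refine ⟨κ, ⟨fun i j hij he => ?_, (balanced_congr (dir_iff_lt x.1.1 hκ) k).2 x.1.2⟩,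
      fun v => (h.1 v (Finset.mem_univ v)).2⟩
    by_cases hd : x.1.1.dir i j
    · exact (hκ i j hd).ne he
    · have := (x.1.1.exactlyOne hij.symm).2 hd
      exact (hκ j i this).ne he.symm
  left_inv κ := by
    apply Subtype.ext
    funext v
    rfl
  right_inv x := by
    obtain ⟨⟨O, hO⟩, ⟨κ, hκ⟩⟩ := x
    have h := (mem_strictCol _ _ _ _).1 hκ
    have hO' : ∀ i j, (G.Adj i j ∧ κ i < κ j) ↔ O.dir i j := by
      intro i j
      constructor
      · rintro ⟨hij, h1⟩
        rw [O.exactlyOne hij]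
        exact fun h2 => lt_asymm h1 (h.2.2 j (Finset.mem_univ j) i (Finset.mem_univ i) h2)
      · intro hd
        exact ⟨O.dir_adj hd, h.2.2 i (Finset.mem_univ i) j (Finset.mem_univ j) hd⟩
    have key : ∀ (O' : GraphOrientation G) (hB : O'.KBalanced k)
        (hm : κ ∈ strictCol O'.dir Finset.univ l), O' = O →
        (⟨⟨O', hB⟩, ⟨κ, hm⟩⟩ : Σ O : {O : GraphOrientation G // O.KBalanced k},
          strictCol O.1.dir Finset.univ l) = ⟨⟨O, hO⟩, ⟨κ, hκ⟩⟩ := by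
      rintro O' hB hm rfl; rfl
    apply key
    exact orient_ext hO'

/-- Let `G` have `n` vertices, `k ≥ 1`, and let `p` be the polynomial with
`p(λ) = χ_G^k(λ)` for all positive integers `λ`.  Then `(−1)^n · p(−1)` equals the number of
`k`-balanced orientations of `G`. -/
theorem stmt15 {V : Type*} [Fintype V] (G : SimpleGraph V) (k : ℕ) (hk : 1 ≤ k)
    (p : Polynomial ℚ)
    (hp : ∀ lam : ℕ, 0 < lam → p.eval (lam : ℚ) = kChromCount G k lam) :
    (-1 : ℚ) ^ (Fintype.card V) * p.eval (-1 : ℚ) =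
      Nat.card {O : GraphOrientation G // O.KBalanced k} := by
  classical
  letI : Fintype {O : GraphOrientation G // O.KBalanced k} := Fintype.ofFinite _
  have hq := fun O : {O : GraphOrientation G // O.KBalanced k} =>
    strictCol_poly O.1.dir (exists_sink O.1 hk O.2) Finset.univ
  choose q hq1 hq2 using hq
  have hpq : p = ∑ O, q O := by
    apply Polynomial.eq_of_infinite_eval_eq
    refine Set.Infinite.mono (s := (fun n : ℕ => ((n + 1 : ℕ) : ℚ)) '' Set.univ) ?_ ?_
    · rintro _ ⟨n, -, rfl⟩
      have : kChromCount G k (n + 1) = ∑ O : {O : GraphOrientation G // O.KBalanced k},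
          (strictCol O.1.dir Finset.univ (n + 1)).card := by
        unfold kChromCount
        rw [Nat.card_congr (colEquiv G k (n + 1)), Nat.card_sigma]
        simp
      rw [Set.mem_setOf_eq]
      dsimp only
      rw [hp (n + 1) n.succ_pos, this, Polynomial.eval_finset_sum,
        Finset.sum_congr rfl fun O _ => hq1 O (n + 1)]
      push_cast
      rfl
    · refine Set.infinite_univ.image ?_
      intro a _ b _ hab
      simpa using hab
  rw [hpq, Polynomial.eval_finset_sum, Finset.sum_congr rfl fun O _ => hq2 O]
  rw [Finset.sum_const, Finset.card_univ, Finset.card_univ, nsmul_eq_mul, mul_left_comm,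
    ← mul_pow, Nat.card_eq_fintype_card]
  simp
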